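/- Let P be a partially ordered set in which the relation > is well-founded. Then the set of antichain subsets of P carries a distributive lattice structure whose join is A ∨ B = (A ∪ B)↑ and whose meet is A ∧ B = (A↓ ∩ B↓)↑; that is, these operations are commutative, associative, idempotent, satisfy both absorption laws, and satisfy A ∧ (B ∨ C) = (A ∧ B) ∨ (A ∧ C). -/

import Mathlib

/-- `upSet A` is the set of maximal elements of `A`: those `a ∈ A` such that
no `a' ∈ A` satisfies `a < a'`. -/
def upSet {P : Type*} [PartialOrder P] (A : Set P) : Set P :=
  {a | a ∈ A ∧ ∀ b ∈ A, ¬ a < b}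

/-- `downSet A` is the down-closure `{p | ∃ a ∈ A, p ≤ a}` of `A`. -/
def downSet {P : Type*} [PartialOrder P] (A : Set P) : Set P :=
  {p | ∃ a ∈ A, p ≤ a}

/-- The join `A ∨ B = (A ∪ B)↑`. -/
def joinA {P : Type*} [PartialOrder P] (A B : Set P) : Set P :=
  upSet (A ∪ B)

/-- The meet `A ∧ B = (A↓ ∩ B↓)↑`. -/
def meetA {P : Type*} [PartialOrder P] (A B : Set P) : Set P :=
  upSet (downSet A ∩ downSet B)

theorem isAntichain_upSet {P : Type*} [PartialOrder P] (S : Set P) :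
    IsAntichain (· ≤ ·) (upSet S) := by
  intro a ha b hb hne hle
  exact ha.2 b hb.1 (lt_of_le_of_ne hle hne)

theorem eq_of_downSet_eq {P : Type*} [PartialOrder P] {A B : Set P}
    (hA : IsAntichain (· ≤ ·) A) (hB : IsAntichain (· ≤ ·) B)
    (h : downSet A = downSet B) : A = B := by
  have key : ∀ A B : Set P, IsAntichain (· ≤ ·) A → downSet A = downSet B → A ⊆ B := by
    intro A B hA h a ha
    have h1 : a ∈ downSet B := h ▸ (⟨a, ha, le_rfl⟩ : a ∈ downSet A)
    obtain ⟨b, hb, hab⟩ := h1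
    have h2 : b ∈ downSet A := h ▸ (⟨b, hb, le_rfl⟩ : b ∈ downSet B)
    obtain ⟨c, hc, hbc⟩ := h2
    have hac : a = c := hA.eq ha hc (hab.trans hbc)
    have : a = b := le_antisymm hab (hac ▸ hbc)
    exact this ▸ hb
  exact Set.Subset.antisymm (key A B hA h) (key B A hB h.symm)

theorem downSet_upSet {P : Type*} [PartialOrder P]
    (hwf : WellFounded ((· > ·) : P → P → Prop)) (S : Set P) :
    downSet (upSet S) = downSet S := by
  ext p
  constructor
  · rintro ⟨a, ha, hpa⟩
    exact ⟨a, ha.1, hpa⟩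
  · rintro ⟨a, ha, hpa⟩
    obtain ⟨m, ⟨hmS, ham⟩, hm⟩ := hwf.has_min {x | x ∈ S ∧ a ≤ x} ⟨a, ha, le_rfl⟩
    exact ⟨m, ⟨hmS, fun b hb hlt => hm b ⟨hb, ham.trans hlt.le⟩ hlt⟩, hpa.trans ham⟩

theorem downSet_joinA {P : Type*} [PartialOrder P]
    (hwf : WellFounded ((· > ·) : P → P → Prop)) (A B : Set P) :
    downSet (joinA A B) = downSet A ∪ downSet B := by
  rw [joinA, downSet_upSet hwf]
  ext p
  simp only [downSet, Set.mem_union, Set.mem_setOf_eq, or_and_right, exists_or]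

theorem downSet_meetA {P : Type*} [PartialOrder P]
    (hwf : WellFounded ((· > ·) : P → P → Prop)) (A B : Set P) :
    downSet (meetA A B) = downSet A ∩ downSet B := by
  rw [meetA, downSet_upSet hwf]
  ext p
  constructor
  · rintro ⟨q, ⟨⟨a, ha, hqa⟩, ⟨b, hb, hqb⟩⟩, hpq⟩
    exact ⟨⟨a, ha, hpq.trans hqa⟩, ⟨b, hb, hpq.trans hqb⟩⟩
  · intro hp
    exact ⟨p, hp, le_rfl⟩

/-- If `>` is well-founded on the partially ordered set `P`, then the antichain
subsets of `P` with `A ∨ B = (A ∪ B)↑` and `A ∧ B = (A↓ ∩ B↓)↑` form a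
distributive lattice: the operations are commutative, associative, idempotent,
satisfy both absorption laws and satisfy `A ∧ (B ∨ C) = (A ∧ B) ∨ (A ∧ C)`. -/
theorem stmt_8 {P : Type*} [PartialOrder P]
    (hwf : WellFounded ((· > ·) : P → P → Prop)) :
    (∀ A B : Set P, IsAntichain (· ≤ ·) A → IsAntichain (· ≤ ·) B →
      joinA A B = joinA B A) ∧
    (∀ A B : Set P, IsAntichain (· ≤ ·) A → IsAntichain (· ≤ ·) B →
      meetA A B = meetA B A) ∧
    (∀ A B C : Set P, IsAntichain (· ≤ ·) A → IsAntichain (· ≤ ·) B →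
      IsAntichain (· ≤ ·) C → joinA A (joinA B C) = joinA (joinA A B) C) ∧
    (∀ A B C : Set P, IsAntichain (· ≤ ·) A → IsAntichain (· ≤ ·) B →
      IsAntichain (· ≤ ·) C → meetA A (meetA B C) = meetA (meetA A B) C) ∧
    (∀ A : Set P, IsAntichain (· ≤ ·) A → joinA A A = A) ∧
    (∀ A : Set P, IsAntichain (· ≤ ·) A → meetA A A = A) ∧
    (∀ A B : Set P, IsAntichain (· ≤ ·) A → IsAntichain (· ≤ ·) B →
      joinA A (meetA A B) = A) ∧
    (∀ A B : Set P, IsAntichain (· ≤ ·) A → IsAntichain (· ≤ ·) B →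
      meetA A (joinA A B) = A) ∧
    (∀ A B C : Set P, IsAntichain (· ≤ ·) A → IsAntichain (· ≤ ·) B →
      IsAntichain (· ≤ ·) C → meetA A (joinA B C) = joinA (meetA A B) (meetA A C)) := by
  have hj : ∀ A B : Set P, IsAntichain (· ≤ ·) (joinA A B) := fun A B => isAntichain_upSet _
  have hm : ∀ A B : Set P, IsAntichain (· ≤ ·) (meetA A B) := fun A B => isAntichain_upSet _
  refine ⟨?_, ?_, ?_, ?_, ?_, ?_, ?_, ?_, ?_⟩
  · intro A B _ _
    apply eq_of_downSet_eq (hj _ _) (hj _ _)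
    simp only [downSet_joinA hwf, Set.union_comm]
  · intro A B _ _
    apply eq_of_downSet_eq (hm _ _) (hm _ _)
    simp only [downSet_meetA hwf, Set.inter_comm]
  · intro A B C _ _ _
    apply eq_of_downSet_eq (hj _ _) (hj _ _)
    simp only [downSet_joinA hwf, Set.union_assoc]
  · intro A B C _ _ _
    apply eq_of_downSet_eq (hm _ _) (hm _ _)
    simp only [downSet_meetA hwf, Set.inter_assoc]
  · intro A hA
    apply eq_of_downSet_eq (hj _ _) hA
    simp only [downSet_joinA hwf, Set.union_self]
  · intro A hA
    apply eq_of_downSet_eq (hm _ _) hA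
    simp only [downSet_meetA hwf, Set.inter_self]
  · intro A B hA _
    apply eq_of_downSet_eq (hj _ _) hA
    rw [downSet_joinA hwf, downSet_meetA hwf]
    exact Set.union_eq_self_of_subset_right Set.inter_subset_left
  · intro A B hA _
    apply eq_of_downSet_eq (hm _ _) hA
    rw [downSet_meetA hwf, downSet_joinA hwf]
    exact Set.inter_eq_self_of_subset_left Set.subset_union_left
  · intro A B C _ _ _
    apply eq_of_downSet_eq (hm _ _) (hj _ _)
    simp only [downSet_meetA hwf, downSet_joinA hwf, Set.inter_union_distrib_left]
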